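/- arXiv:2302.10867 — 2 statements merged into one kernel-verified Lean document; each statement's English description precedes it below -/
import Mathlib

section
/- Let t₀ ∈ k^× be a unit. Define an involution σ on A[x]/(x²−t₀) by σ(a + bx) = θ(a) − θ(b)x. Then the fixed point subalgebra of σ equals A^θ ⊕ A^{-θ}·x, and it is isomorphic as a k-algebra to the fiber A_{t₀} := A_t/(t − t₀) of the contraction algebra at t = t₀. -/
open LaurentPolynomial

/-- `A_t`: the `k[t^{±1}]`-subalgebra of `A[√t^{±1}]` generated by `A^θ` and
`(1/√t)·A^{-θ}`, i.e. `A^θ[t^{±1}] ⊕ (1/√t)A^{-θ} ⊗ k[t^{±1}]`. -/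
noncomputable def contractionT (k A : Type*) [CommRing k] [CommRing A] [Algebra k A]
    (θ : A →ₐ[k] A) : Subalgebra k (LaurentPolynomial A) :=
  Algebra.adjoin k (insert (T 2) (insert (T (-2))
    ({f | ∃ a, θ a = a ∧ f = C a} ∪ {f | ∃ a, θ a = -a ∧ f = C a * T (-1)})))

theorem tSubT0_mem_contractionT {k A : Type*} [CommRing k] [CommRing A] [Algebra k A]
    (θ : A →ₐ[k] A) (t₀ : k) :
    (T 2 - C (algebraMap k A t₀) : LaurentPolynomial A) ∈ contractionT k A θ :=
  sub_mem (Algebra.subset_adjoin (Set.mem_insert _ _))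
    (show algebraMap k (LaurentPolynomial A) t₀ ∈ _ from
      Subalgebra.algebraMap_mem _ t₀)

/-- The fiber `A_{t₀} = A_t/(t - t₀)` of the contraction algebra at a unit `t₀`. -/
noncomputable abbrev contractionFiber (k A : Type*) [CommRing k] [CommRing A] [Algebra k A]
    (θ : A →ₐ[k] A) (t₀ : k) :=
  ↥(contractionT k A θ) ⧸
    (Ideal.span {(⟨T 2 - C (algebraMap k A t₀), tSubT0_mem_contractionT θ t₀⟩ :
      ↥(contractionT k A θ))})



/-- The unit `√t` of the Laurent polynomial ring. -/
noncomputable def sqrtUnit (A : Type*) [CommRing A] : (LaurentPolynomial A)ˣ :=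
  ⟨T 1, T (-1), by rw [← T_add]; simp, by rw [← T_add]; simp⟩

theorem sqrtUnit_zpow (A : Type*) [CommRing A] (n : ℤ) :
    ((sqrtUnit A ^ n : (LaurentPolynomial A)ˣ) : LaurentPolynomial A) = T n := by
  induction n using Int.induction_on with
  | zero => simp
  | succ n ih => rw [zpow_add_one, Units.val_mul, ih, T_add]; rfl
  | pred n ih => rw [zpow_sub_one, Units.val_mul, ih, T_sub]; rfl

/-- The lift of the involution to the Laurent polynomial ring. -/
noncomputable def bigTheta {k A : Type*} [CommRing k] [CommRing A] [Algebra k A]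
    (θ : A →ₐ[k] A) : LaurentPolynomial A →ₐ[k] LaurentPolynomial A :=
  { eval₂ ((C : A →+* LaurentPolynomial A).comp θ.toRingHom) (-sqrtUnit A) with
    commutes' := by
      intro r
      change eval₂ _ _ (C (algebraMap k A r)) = C (algebraMap k A r)
      rw [eval₂_C]
      simp }

section
variable {k A : Type*} [CommRing k] [CommRing A] [Algebra k A] (θ : A →ₐ[k] A)

theorem bigTheta_C (a : A) : bigTheta θ (C a) = C (θ a) := by
  change eval₂ _ _ (C a) = _
  rw [eval₂_C]; rfl

theorem bigTheta_even (n : ℤ) (hn : Even n) : bigTheta θ (T n) = T n := by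
  change eval₂ _ _ (T n) = _
  rw [eval₂_T, hn.neg_zpow, sqrtUnit_zpow]

theorem bigTheta_odd (n : ℤ) (hn : Odd n) : bigTheta θ (T n) = - T n := by
  obtain ⟨m, rfl⟩ := hn
  rw [T_add, map_mul, bigTheta_even θ _ (even_two_mul m)]
  change _ * eval₂ _ _ (T 1) = _
  rw [eval₂_T, zpow_one, Units.val_neg, ← mul_neg]
  rfl

theorem C_mem_contractionT {a : A} (ha : θ a = a) : C a ∈ contractionT k A θ :=
  Algebra.subset_adjoin (by right; right; left; exact ⟨a, ha, rfl⟩)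

theorem T_even_mem_contractionT (m : ℤ) : (T (2 * m) : LaurentPolynomial A) ∈ contractionT k A θ := by
  have h2 : (T 2 : LaurentPolynomial A) ∈ contractionT k A θ :=
    Algebra.subset_adjoin (by left; rfl)
  have h2' : (T (-2) : LaurentPolynomial A) ∈ contractionT k A θ :=
    Algebra.subset_adjoin (by right; left; rfl)
  obtain ⟨n, rfl | rfl⟩ := m.eq_nat_or_neg
  · have := pow_mem h2 n
    rwa [T_pow, mul_comm] at this
  · have := pow_mem h2' n
    rw [T_pow] at this
    convert this using 2
    ring

theorem CT_odd_mem_contractionT {a : A} (ha : θ a = -a) (m : ℤ) :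
    C a * T (2 * m + 1) ∈ contractionT k A θ := by
  have h : C a * T (-1) ∈ contractionT k A θ :=
    Algebra.subset_adjoin (by right; right; right; exact ⟨a, ha, rfl⟩)
  have := mul_mem h (T_even_mem_contractionT θ (m + 1))
  rw [mul_assoc, ← T_add] at this
  convert this using 3
  ring

theorem bigTheta_fix {f : LaurentPolynomial A} (hf : f ∈ contractionT k A θ) :
    bigTheta θ f = f := by
  have : contractionT k A θ ≤ AlgHom.equalizer (bigTheta θ) (AlgHom.id k _) := by
    refine Algebra.adjoin_le ?_
    rintro f (rfl | rfl | ⟨a, ha, rfl⟩ | ⟨a, ha, rfl⟩)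
    · exact bigTheta_even θ _ (by decide)
    · exact bigTheta_even θ _ (by decide)
    · change bigTheta θ _ = _
      rw [bigTheta_C, ha]; rfl
    · change bigTheta θ _ = _
      rw [map_mul, bigTheta_C, bigTheta_odd θ _ (by decide), ha, map_neg, neg_mul_neg]; rfl
  exact this hf

theorem avg_mem (hθ : θ.comp θ = AlgHom.id k A) (f : LaurentPolynomial A) :
    f + bigTheta θ f ∈ contractionT k A θ := by
  have hh : ∀ a, θ (θ a) = a := fun a => DFunLike.congr_fun hθ a
  induction f using LaurentPolynomial.induction_on' with
  | add p q hp hq =>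
    rw [map_add, add_add_add_comm]
    exact add_mem hp hq
  | C_mul_T n a =>
    rw [map_mul, bigTheta_C]
    obtain ⟨m, rfl | rfl⟩ := n.even_or_odd'
    · rw [bigTheta_even θ _ (even_two_mul m), ← add_mul, ← map_add]
      exact mul_mem (C_mem_contractionT θ (by rw [map_add, hh, add_comm]))
        (T_even_mem_contractionT θ m)
    · rw [bigTheta_odd θ _ ⟨m, rfl⟩, mul_neg, ← neg_mul, ← map_neg, ← add_mul, ← map_add]
      exact CT_odd_mem_contractionT θ (by rw [map_add, map_neg, hh]; ring) m

theorem mk_T_two (t₀ : k) :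
    Ideal.Quotient.mkₐ k (Ideal.span {(T 2 - C (algebraMap k A t₀) : LaurentPolynomial A)}) (T 2)
      = algebraMap k _ t₀ := by
  rw [← AlgHom.commutes (Ideal.Quotient.mkₐ k
    (Ideal.span {(T 2 - C (algebraMap k A t₀) : LaurentPolynomial A)}))]
  exact (Ideal.Quotient.mk_eq_mk_iff_sub_mem _ _).2 (Ideal.subset_span rfl)

theorem mk_T_even (t₀ : k) (ht₀ : IsUnit t₀) (m : ℤ) : ∃ c : k,
    Ideal.Quotient.mkₐ k (Ideal.span {(T 2 - C (algebraMap k A t₀) : LaurentPolynomial A)})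
      (T (2 * m)) = algebraMap k _ c := by
  have h2 := mk_T_two (A := A) t₀
  obtain ⟨u, rfl⟩ := ht₀
  have h2' : Ideal.Quotient.mkₐ k
      (Ideal.span {(T 2 - C (algebraMap k A u) : LaurentPolynomial A)}) (T (-2))
      = algebraMap k _ (↑u⁻¹ : k) := by
    have h : Ideal.Quotient.mkₐ k
      (Ideal.span {(T 2 - C (algebraMap k A u) : LaurentPolynomial A)}) (T 2 * T (-2)) = 1 := by
      rw [← T_add]; simp
    rw [map_mul, h2] at h
    calc _ = algebraMap k _ (↑u⁻¹ : k) * (algebraMap k _ (u : k) * _) := by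
            rw [← mul_assoc, ← map_mul, Units.inv_mul, map_one, one_mul]
      _ = _ := by rw [h, mul_one]
  obtain ⟨n, rfl | rfl⟩ := m.eq_nat_or_neg
  · refine ⟨(u : k) ^ n, ?_⟩
    rw [map_pow, ← h2, ← map_pow, T_pow, mul_comm]
  · refine ⟨(↑u⁻¹ : k) ^ n, ?_⟩
    rw [map_pow, ← h2', ← map_pow, T_pow]
    congr 2
    ring

theorem exists_rep (t₀ : k) (ht₀ : IsUnit t₀) (f : LaurentPolynomial A) : ∃ a b : A,
    Ideal.Quotient.mkₐ k (Ideal.span {(T 2 - C (algebraMap k A t₀) : LaurentPolynomial A)}) f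
    = Ideal.Quotient.mkₐ k _ (C a + C b * T 1) := by
  induction f using LaurentPolynomial.induction_on' with
  | add p q hp hq =>
    obtain ⟨a, b, h⟩ := hp
    obtain ⟨a', b', h'⟩ := hq
    refine ⟨a + a', b + b', ?_⟩
    rw [map_add, h, h', ← map_add]
    congr 1
    simp only [map_add]
    ring
  | C_mul_T n a =>
    obtain ⟨m, rfl | rfl⟩ := n.even_or_odd'
    · obtain ⟨c, hc⟩ := mk_T_even (A := A) t₀ ht₀ m
      refine ⟨a * algebraMap k A c, 0, ?_⟩
      rw [map_mul, hc, map_zero, zero_mul, add_zero, map_mul, map_mul]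
      congr 1
    · obtain ⟨c, hc⟩ := mk_T_even (A := A) t₀ ht₀ m
      refine ⟨0, a * algebraMap k A c, ?_⟩
      rw [T_add, map_mul, map_mul, hc, map_zero, zero_add, map_mul, map_mul, map_mul, mul_assoc]
      congr 1
end

/-!
STATEMENT 3: let `t₀ ∈ k^×` and let `σ` be the involution
`a + b x ↦ θ(a) - θ(b) x` of `A[x]/(x² - t₀)` (realized, since `t₀` is a
unit, as the quotient of `A[√t^{±1}]` by the ideal `(√t² - t₀)`, with
`x` the class of `√t`; on monomials `σ(a xⁿ) = (-1)ⁿ θ(a) xⁿ`).  Then the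
fixed-point subalgebra of `σ` is `A^θ ⊕ A^{-θ}·x`, and it is isomorphic as a
`k`-algebra to the fiber `A_{t₀} = A_t/(t - t₀)`. -/
theorem fixedPoints_of_quadratic_involution
    (k A : Type*) [CommRing k] [CommRing A] [Algebra k A] [Invertible (2 : k)]
    (θ : A →ₐ[k] A) (hθ : θ.comp θ = AlgHom.id k A)
    (t₀ : k) (ht₀ : IsUnit t₀)
    (σ : (LaurentPolynomial A ⧸
            Ideal.span {(T 2 - C (algebraMap k A t₀) : LaurentPolynomial A)}) →ₐ[k]
         (LaurentPolynomial A ⧸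
            Ideal.span {(T 2 - C (algebraMap k A t₀) : LaurentPolynomial A)}))
    (hσ : ∀ (a : A) (n : ℤ),
      σ (Ideal.Quotient.mkₐ k _ (C a * T n)) =
        Ideal.Quotient.mkₐ k _ (C (((n.negOnePow : ℤ)) • θ a) * T n)) :
    (∀ q, σ q = q ↔ ∃ a b : A, θ a = a ∧ θ b = -b ∧
        q = Ideal.Quotient.mkₐ k _ (C a + C b * T 1)) ∧
    Nonempty
      (↥(AlgHom.equalizer σ (AlgHom.id k _)) ≃ₐ[k] contractionFiber k A θ t₀) := by
  classical
  let I : Ideal (LaurentPolynomial A) :=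
    Ideal.span {(T 2 - C (algebraMap k A t₀) : LaurentPolynomial A)}
  have hI : I = Ideal.span {(T 2 - C (algebraMap k A t₀) : LaurentPolynomial A)} := rfl
  have hh : ∀ a, θ (θ a) = a := fun a => DFunLike.congr_fun hθ a
  have hσΘ : ∀ f, σ (Ideal.Quotient.mkₐ k I f) = Ideal.Quotient.mkₐ k I (bigTheta θ f) := by
    intro f
    induction f using LaurentPolynomial.induction_on' with
    | add p q hp hq => simp only [map_add, hp, hq]
    | C_mul_T n a =>
      refine (hσ a n).trans ?_
      congr 1
      rw [map_mul, bigTheta_C]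
      rcases n.even_or_odd with hn | hn
      · rw [Int.negOnePow_even n hn, bigTheta_even θ n hn]; simp
      · rw [Int.negOnePow_odd n hn, bigTheta_odd θ n hn]; simp
  have half : ∀ (M : Type _) [AddCommGroup M] [Module k M] (x : M), (⅟2 : k) • (x + x) = x := by
    intro M _ _ x
    rw [← two_smul k, smul_smul, invOf_mul_self, one_smul]
  have part1 : ∀ q, σ q = q ↔ ∃ a b : A, θ a = a ∧ θ b = -b ∧
        q = Ideal.Quotient.mkₐ k I (C a + C b * T 1) := by
    intro q
    constructor
    · intro hq
      obtain ⟨f, rfl⟩ := Ideal.Quotient.mkₐ_surjective k I q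
      obtain ⟨a, b, hab⟩ := exists_rep t₀ ht₀ f
      change Ideal.Quotient.mkₐ k I f = Ideal.Quotient.mkₐ k I _ at hab
      rw [hab] at hq ⊢
      refine ⟨(⅟2 : k) • (a + θ a), (⅟2 : k) • (b - θ b), ?_, ?_, ?_⟩
      · rw [map_smul, map_add, hh, add_comm]
      · rw [map_smul, map_sub, hh, ← smul_neg, neg_sub]
      · have hC : ∀ (c : k) (x : A), (C (c • x) : LaurentPolynomial A) = c • C x := by
          intro c x
          rw [Algebra.smul_def, Algebra.smul_def, map_mul]; rfl
        conv_lhs => rw [← half _ (Ideal.Quotient.mkₐ k I (C a + C b * T 1))]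
        nth_rewrite 2 [← hq]
        rw [hσΘ, ← map_add, ← map_smul]
        congr 1
        rw [hC, hC, map_add, map_mul, bigTheta_C, bigTheta_C, bigTheta_odd θ 1 (by decide),
          smul_mul_assoc, ← smul_add]
        congr 1
        simp only [map_add, map_sub]
        ring
    · rintro ⟨a, b, ha, hb, rfl⟩
      rw [hσΘ, map_add, map_mul, bigTheta_C, bigTheta_C, bigTheta_odd θ 1 (by decide), ha, hb,
        map_neg, neg_mul_neg]
  refine ⟨part1, ?_⟩
  let φ : ↥(contractionT k A θ) →ₐ[k] ↥(AlgHom.equalizer σ (AlgHom.id k _)) :=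
    ((Ideal.Quotient.mkₐ k I).comp (contractionT k A θ).val).codRestrict _ (by
      intro s
      change σ (Ideal.Quotient.mkₐ k I s) = Ideal.Quotient.mkₐ k I s
      rw [hσΘ, bigTheta_fix θ s.2])
  have hφ : Function.Surjective φ := by
    rintro ⟨q, hq⟩
    obtain ⟨a, b, ha, hb, rfl⟩ := (part1 q).1 hq
    refine ⟨⟨C a + C b * T 1, add_mem (C_mem_contractionT θ ha) ?_⟩, rfl⟩
    simpa using CT_odd_mem_contractionT θ hb 0
  have hker : RingHom.ker φ = Ideal.span {(⟨T 2 - C (algebraMap k A t₀),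
      tSubT0_mem_contractionT θ t₀⟩ : ↥(contractionT k A θ))} := by
    apply le_antisymm
    · intro s hs
      have hs1 : Ideal.Quotient.mk I (s : LaurentPolynomial A) = 0 :=
        congrArg Subtype.val (show φ s = 0 from hs)
      rw [Ideal.Quotient.eq_zero_iff_mem, hI, Ideal.mem_span_singleton'] at hs1
      obtain ⟨g, hg⟩ := hs1
      rw [Ideal.mem_span_singleton']
      refine ⟨⟨(⅟2 : k) • (g + bigTheta θ g), Subalgebra.smul_mem _ (avg_mem θ hθ g) _⟩, ?_⟩
      apply Subtype.ext
      change ((⅟2 : k) • (g + bigTheta θ g)) * (T 2 - C (algebraMap k A t₀)) = (s : LaurentPolynomial A)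
      have h2 : bigTheta θ g * (T 2 - C (algebraMap k A t₀)) = (s : LaurentPolynomial A) := by
        rw [← bigTheta_fix θ s.2, ← hg, map_mul, bigTheta_fix θ (tSubT0_mem_contractionT θ t₀)]
      rw [smul_mul_assoc, add_mul, hg, h2, half]
    · rw [Ideal.span_singleton_le_iff_mem]
      change φ _ = 0
      apply Subtype.ext
      exact Ideal.Quotient.eq_zero_iff_mem.2 (Ideal.subset_span rfl)
  exact ⟨((Ideal.quotientEquivAlgOfEq k hker.symm).trans
    (Ideal.quotientKerAlgEquivOfSurjective hφ)).symm⟩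
end

section
/- Let R be a Noetherian commutative ring and p : B → C a surjective homomorphism of smooth commutative R-algebras with kernel J. Then the extended Rees algebra B[u, Ju^{-1}] = B[u] ⊕ ⊕_{n≥1} J^n u^{-n} ⊆ B[u^{±1}] is smooth over R[u]. -/
open LaurentPolynomial

/-- The extended Rees algebra `B[u, Ju⁻¹] = B[u] ⊕ ⊕_{n≥1} Jⁿ u⁻ⁿ ⊆ B[u^{±1}]`
of a pair `(B, J)`, realized inside the Laurent polynomial ring (with `u = T 1`)
as the `R`-subalgebra generated by `B`, `u` and `J·u⁻¹`. -/
noncomputable def extendedRees (R B : Type*) [CommRing R] [CommRing B] [Algebra R B]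
    (J : Ideal B) : Subalgebra R (LaurentPolynomial B) :=
  Algebra.adjoin R (insert (T 1)
    ({f | ∃ b : B, f = C b} ∪ {f | ∃ b ∈ J, f = C b * T (-1)}))

theorem u_mem_extendedRees {R B : Type*} [CommRing R] [CommRing B] [Algebra R B]
    (J : Ideal B) : (T 1 : LaurentPolynomial B) ∈ extendedRees R B J :=
  Algebra.subset_adjoin (Set.mem_insert _ _)

open TensorProduct

section L1
variable {R K B : Type*} [CommRing R] [CommRing K] [CommRing B] [Algebra R K] [Algebra R B]

/-- relations -/
noncomputable def reesRel {ι : Type*} (u : K) (x : ι → B) (g : K ⊗[R] B) :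
    Option ι → MvPolynomial (Option ι) (K ⊗[R] B)
  | none => MvPolynomial.C g * MvPolynomial.X none - 1
  | some i => MvPolynomial.C (u ⊗ₜ 1) * MvPolynomial.X (some i) - MvPolynomial.C (1 ⊗ₜ x i)

/-- the model -/
abbrev ReesModel {ι : Type*} (u : K) (x : ι → B) (g : K ⊗[R] B) :=
  MvPolynomial (Option ι) (K ⊗[R] B) ⧸ Ideal.span (Set.range (reesRel u x g))

theorem exists_unit_lift {S : Type*} [CommRing S] (N : Ideal S) (hN : N ^ 2 = ⊥) (a z : S)
    (h : a * z - 1 ∈ N) : ∃ w, a * w = 1 := by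
  have h2 : (a * z - 1) ^ 2 = 0 := by
    have := Ideal.pow_mem_pow h 2
    rwa [hN] at this
  exact ⟨z * (2 - a * z), by linear_combination -h2⟩

/-- correct a hom by a derivation -/
theorem exists_corrected {S : Type*} [CommRing S] [Algebra R S] (N : Ideal S) (hN : N ^ 2 = ⊥)
    {ι : Type*} [Fintype ι] (φ : B →ₐ[R] S) (c : ι → S) (hc : ∀ i, c i ∈ N)
    (D : ι → Derivation R B B) :
    ∃ φ' : B →ₐ[R] S, ∀ b, φ' b = φ b + ∑ i, c i * φ (D i b) := by
  have hcc : ∀ i j, c i * c j = 0 := by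
    intro i j
    have := Ideal.mul_mem_mul (hc i) (hc j)
    rwa [← pow_two, hN] at this
  refine ⟨AlgHom.ofLinearMap (φ.toLinearMap + ∑ i, (LinearMap.mulLeft R (c i)) ∘ₗ φ.toLinearMap ∘ₗ
    (D i).toLinearMap) ?_ ?_, ?_⟩
  · simp
  · intro a b
    have h0 : (∑ i, c i * φ (D i a)) * (∑ i, c i * φ (D i b)) = 0 := by
      rw [Finset.sum_mul_sum]
      refine Finset.sum_eq_zero fun i _ => Finset.sum_eq_zero fun j _ => ?_
      linear_combination (φ (D i a) * φ (D j b)) * hcc i j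
    have h1 : ∑ i, c i * φ (D i (a * b)) = φ a * (∑ i, c i * φ (D i b)) +
        φ b * (∑ i, c i * φ (D i a)) := by
      rw [Finset.mul_sum, Finset.mul_sum, ← Finset.sum_add_distrib]
      refine Finset.sum_congr rfl fun i _ => ?_
      simp
      ring
    simp only [LinearMap.add_apply, LinearMap.sum_apply, LinearMap.comp_apply,
      LinearMap.mulLeft_apply, AlgHom.toLinearMap_apply, Derivation.coeFn_coe]
    rw [h1, map_mul]
    linear_combination -h0
  · intro b
    simp
end L1

section L1b
universe u
variable {R K B : Type u} [CommRing R] [CommRing K] [CommRing B] [Algebra R K] [Algebra R B]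

theorem ReesModel.smooth [Algebra.Smooth R B] {ι : Type u} [Fintype ι] [DecidableEq ι] (u : K)
    (x : ι → B) (g : K ⊗[R] B) (D : ι → Derivation R B B)
    (hD : ∀ i j, (1 : K) ⊗ₜ[R] (D i (x j)) = if i = j then g else 0) :
    Algebra.Smooth K (ReesModel u x g) := by
  refine ⟨?_, ?_⟩
  · refine .of_comp_surjective fun S _ _ N hN f ↦ ?_
    let := ((algebraMap K S).comp (algebraMap R K)).toAlgebra
    have : IsScalarTower R K S := IsScalarTower.of_algebraMap_eq' rfl
    let π : MvPolynomial (Option ι) (K ⊗[R] B) →ₐ[K ⊗[R] B] ReesModel u x g := Ideal.Quotient.mkₐ _ _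
    let f0 : (K ⊗[R] B) →ₐ[K] S ⧸ N := f.comp (IsScalarTower.toAlgHom K (K ⊗[R] B) (ReesModel u x g))
    let f1 : B →ₐ[R] S ⧸ N := (f0.restrictScalars R).comp Algebra.TensorProduct.includeRight
    let φ : B →ₐ[R] S := Algebra.FormallySmooth.lift N ⟨2, hN⟩ f1
    have hφ : ∀ b, Ideal.Quotient.mk N (φ b) = f1 b := fun b => Algebra.FormallySmooth.mk_lift _ _ _ _
    choose y hy using fun o : Option ι => Ideal.Quotient.mk_surjective (f (π (MvPolynomial.X o)))
    let ext (χ : B →ₐ[R] S) : (K ⊗[R] B) →ₐ[K] S :=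
      Algebra.TensorProduct.productLeftAlgHom (Algebra.ofId K S) χ
    have hext (χ : B →ₐ[R] S) (hχ : ∀ b, Ideal.Quotient.mk N (χ b) = f1 b) (t) :
        Ideal.Quotient.mk N (ext χ t) = f0 t := by
      have : (Ideal.Quotient.mkₐ K N).comp (ext χ) = f0 := by
        apply Algebra.TensorProduct.ext
        · ext
        · ext b
          simp [ext, hχ, f1]
      exact congr($this t)
    have hrel (o) : π (reesRel u x g o) = 0 :=
      Ideal.Quotient.eq_zero_iff_mem.mpr (Ideal.subset_span ⟨o, rfl⟩)
    have hπC (t) : f (π (MvPolynomial.C t)) = f0 t := rfl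
    have hr0 : f0 g * f (π (MvPolynomial.X none)) = 1 := by
      have := congr(f $(hrel none))
      simp only [reesRel, map_sub, map_mul, map_one, map_zero, hπC] at this
      exact sub_eq_zero.mp this
    have hr1 (i) : f0 (u ⊗ₜ 1) * f (π (MvPolynomial.X (some i))) = f0 (1 ⊗ₜ x i) := by
      have := congr(f $(hrel (some i)))
      simp only [reesRel, map_sub, map_mul, map_zero, hπC] at this
      exact sub_eq_zero.mp this
    have hunit (χ : B →ₐ[R] S) (hχ : ∀ b, Ideal.Quotient.mk N (χ b) = f1 b) :
        ∃ w, ext χ g * w = 1 := by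
      refine exists_unit_lift N hN _ (y none) ?_
      rw [← Ideal.Quotient.eq_zero_iff_mem]
      simp [hext χ hχ, hy, hr0]
    obtain ⟨w, hw⟩ := hunit φ hφ
    have hextu (χ : B →ₐ[R] S) : ext χ (u ⊗ₜ 1) = algebraMap K S u := by
      simp [ext, Algebra.ofId_apply]
    have hextx (χ : B →ₐ[R] S) (b) : ext χ (1 ⊗ₜ b) = χ b := by
      simp [ext]
    obtain ⟨φ', hφ'⟩ := exists_corrected N hN φ
      (fun i => w * (algebraMap K S u * y (some i) - φ (x i))) (fun i => by
        apply N.mul_mem_left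
        rw [← Ideal.Quotient.eq_zero_iff_mem, ← hextu φ, ← hextx φ]
        simp only [map_sub, map_mul, hext φ hφ, hy, hr1, sub_self]) D
    have hφ'1 : ∀ b, Ideal.Quotient.mk N (φ' b) = f1 b := by
      intro b
      rw [hφ', map_add, hφ, map_sum, add_eq_left]
      refine Finset.sum_eq_zero fun i _ => ?_
      have : Ideal.Quotient.mk N (algebraMap K S u * y (some i) - φ (x i)) = 0 := by
        rw [← hextu φ, ← hextx φ]
        simp only [map_sub, map_mul, hext φ hφ, hy, hr1, sub_self]
      simp only [map_mul, this, mul_zero, zero_mul]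
    have hφ'x (j) : φ' (x j) = algebraMap K S u * y (some j) := by
      have h1 (i) : φ (D i (x j)) = if i = j then ext φ g else 0 := by
        rw [← hextx φ, hD]; split_ifs <;> simp
      rw [hφ']
      simp only [h1, mul_ite, mul_zero, Finset.sum_ite_eq', Finset.mem_univ, if_true]
      linear_combination (algebraMap K S u * y (some j) - φ (x j)) * hw
    obtain ⟨w', hw'⟩ := hunit φ' hφ'1
    have hw'z : Ideal.Quotient.mk N w' = f (π (MvPolynomial.X none)) := by
      have := congr(Ideal.Quotient.mk N $hw')
      rw [map_mul, hext φ' hφ'1, map_one] at this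
      linear_combination f (π (MvPolynomial.X none)) * this - Ideal.Quotient.mk N w' * hr0
    let : Algebra (K ⊗[R] B) S := (ext φ').toRingHom.toAlgebra
    have halg (t) : algebraMap (K ⊗[R] B) S t = ext φ' t := rfl
    have : IsScalarTower K (K ⊗[R] B) S := .of_algebraMap_eq fun k => by
      rw [halg, AlgHom.commutes]
    let v : Option ι → S := fun o => o.elim w' (fun i => y (some i))
    let F : MvPolynomial (Option ι) (K ⊗[R] B) →ₐ[K ⊗[R] B] S := MvPolynomial.aeval v
    have hF : ∀ a ∈ Ideal.span (Set.range (reesRel u x g)), F a = 0 := by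
      change Ideal.span (Set.range (reesRel u x g)) ≤ RingHom.ker F.toRingHom
      rw [Ideal.span_le]
      rintro _ ⟨o, rfl⟩
      change F _ = 0
      cases o with
      | none => simp [reesRel, F, v, halg, hw']
      | some i => simp only [reesRel, F, v, map_sub, map_mul, MvPolynomial.aeval_C,
          MvPolynomial.aeval_X, halg, hextu, hextx, hφ'x, Option.elim, sub_self]
    refine ⟨Ideal.Quotient.liftₐ _ (F.restrictScalars K) hF, ?_⟩
    apply AlgHom.ext
    intro e
    obtain ⟨P, rfl⟩ := Ideal.Quotient.mk_surjective e
    change Ideal.Quotient.mk N (F P) = f (π P)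
    induction P using MvPolynomial.induction_on with
    | C a => rw [hπC, ← hext φ' hφ'1, ← halg]; simp [F]
    | add p q hp hq => simp only [map_add, hp, hq]
    | mul_X p o hp =>
      simp only [map_mul, hp]
      congr 1
      cases o with
      | none => simp [F, v, hw'z]
      | some i => simp [F, v, hy]
  · have : Algebra.FinitePresentation K (MvPolynomial (Option ι) (K ⊗[R] B)) :=
      .trans K (K ⊗[R] B) _
    refine Algebra.FinitePresentation.quotient ?_
    exact ⟨(Set.finite_range (reesRel u x g)).toFinset, by simp⟩
end L1b

section L2
universe u
variable {R K B : Type u} [CommRing R] [CommRing K] [CommRing B] [Algebra R K] [Algebra R B]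

theorem reesModel_core {ι : Type u}
    (u : K) (hu : u ∈ nonZeroDivisors K)
    (x : ι → B) (g : K ⊗[R] B)
    {E : Type u} [CommRing E] [Algebra K E] [Algebra (K ⊗[R] B) E] [IsScalarTower K (K ⊗[R] B) E]
    (hinj : Function.Injective (algebraMap (K ⊗[R] B) E)) (y : ι → E)
    (hy : ∀ i, algebraMap K E u * y i = algebraMap (K ⊗[R] B) E (1 ⊗ₜ x i))
    (hsurj : ∀ e : E, ∃ (n : ℕ) (P : MvPolynomial ι (K ⊗[R] B)),
      MvPolynomial.aeval y P = algebraMap (K ⊗[R] B) E g ^ n * e)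
    {M : Type u} [CommRing M] [Algebra K M] [Algebra (K ⊗[R] B) M] [IsScalarTower K (K ⊗[R] B) M]
    [Algebra.Smooth K M] (π : MvPolynomial (Option ι) (K ⊗[R] B) →ₐ[K ⊗[R] B] M)
    (hπs : Function.Surjective π) (hrel : ∀ o, π (reesRel u x g o) = 0)
    (hlift : ∀ F : MvPolynomial (Option ι) (K ⊗[R] B) →ₐ[K ⊗[R] B]
      Localization.Away (algebraMap (K ⊗[R] B) E g), (∀ o, F (reesRel u x g o) = 0) →
      ∃ ψ : M →ₐ[K ⊗[R] B] Localization.Away (algebraMap (K ⊗[R] B) E g), ∀ P, ψ (π P) = F P) :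
    Algebra.Smooth K (Localization.Away (algebraMap (K ⊗[R] B) E g)) := by
  set G := algebraMap (K ⊗[R] B) E g with hG
  let A := Localization.Away G
  have : IsScalarTower K (K ⊗[R] B) A := inferInstance
  let z : A := IsLocalization.Away.invSelf G
  have hz : algebraMap E A G * z = 1 := IsLocalization.Away.mul_invSelf G
  let v : Option ι → A := fun o => o.elim z (fun i => algebraMap E A (y i))
  let F : MvPolynomial (Option ι) (K ⊗[R] B) →ₐ[K ⊗[R] B] A := MvPolynomial.aeval v
  have hKB (t) : algebraMap (K ⊗[R] B) A t = algebraMap E A (algebraMap _ E t) :=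
    IsScalarTower.algebraMap_apply _ _ _ _
  have hut : (u ⊗ₜ[R] (1 : B)) = algebraMap K (K ⊗[R] B) u := rfl
  have hF (o) : F (reesRel u x g o) = 0 := by
    cases o with
    | none => simp only [reesRel, F, v, map_sub, map_mul, MvPolynomial.aeval_C, map_one,
        MvPolynomial.aeval_X, Option.elim, hKB, ← hG, hz, sub_self]
    | some i =>
      simp only [reesRel, F, v, map_sub, map_mul, MvPolynomial.aeval_C,
          MvPolynomial.aeval_X, Option.elim, hKB, hut, ← IsScalarTower.algebraMap_apply K _ E]
      rw [← map_mul, hy, sub_self]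
  obtain ⟨ψ, hψπ⟩ := hlift F hF
  have hπC (t) : π (MvPolynomial.C t) = algebraMap (K ⊗[R] B) M t := π.commutes t
  have hr0 : algebraMap (K ⊗[R] B) M g * π (MvPolynomial.X none) = 1 := by
    have := hrel none
    simp only [reesRel, map_sub, map_mul, map_one, hπC] at this
    exact sub_eq_zero.mp this
  have hr1 (i) : algebraMap (K ⊗[R] B) M (u ⊗ₜ 1) * π (MvPolynomial.X (some i)) =
      algebraMap (K ⊗[R] B) M (1 ⊗ₜ x i) := by
    have := hrel (some i)
    simp only [reesRel, map_sub, map_mul, hπC] at this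
    exact sub_eq_zero.mp this
  have hreg (m : M) (n : ℕ) (h : algebraMap (K ⊗[R] B) M (u ⊗ₜ 1 * g) ^ n * m = 0) : m = 0 := by
    have hgu : algebraMap (K ⊗[R] B) M g ^ n * π (MvPolynomial.X none) ^ n = 1 := by
      rw [← mul_pow, hr0, one_pow]
    have h1 : algebraMap K M u ^ n * m = 0 := by
      have h2 : algebraMap (K ⊗[R] B) M (u ⊗ₜ[R] (1 : B)) ^ n * m = 0 := by
        rw [map_mul, mul_pow] at h
        linear_combination π (MvPolynomial.X none) ^ n * h -
          algebraMap (K ⊗[R] B) M (u ⊗ₜ[R] (1 : B)) ^ n * m * hgu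
      rwa [hut, ← IsScalarTower.algebraMap_apply K _ M] at h2
    have h2 := Module.Flat.isSMulRegular_of_nonZeroDivisors (M := M) (pow_mem hu n)
    apply h2
    simp only [smul_zero]
    rw [Algebra.smul_def, map_pow, h1]
  have hpow (m : M) : ∃ (n : ℕ) (t : K ⊗[R] B),
      algebraMap (K ⊗[R] B) M (u ⊗ₜ 1 * g) ^ n * m = algebraMap (K ⊗[R] B) M t := by
    obtain ⟨P, rfl⟩ := hπs m
    induction P using MvPolynomial.induction_on with
    | C a => exact ⟨0, a, by simp [hπC]⟩
    | add p q hp hq =>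
      obtain ⟨n, t, h⟩ := hp
      obtain ⟨n', t', h'⟩ := hq
      refine ⟨n + n', (u ⊗ₜ 1 * g) ^ n' * t + (u ⊗ₜ 1 * g) ^ n * t', ?_⟩
      simp only [map_add, map_mul, map_pow] at h h' ⊢
      rw [← h, ← h']
      ring
    | mul_X p o hp =>
      obtain ⟨n, t, h⟩ := hp
      have : ∃ s, algebraMap (K ⊗[R] B) M (u ⊗ₜ 1 * g) * π (MvPolynomial.X o) = algebraMap (K ⊗[R] B) M s := by
        cases o with
        | none =>
          refine ⟨u ⊗ₜ 1, ?_⟩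
          rw [map_mul]
          linear_combination algebraMap (K ⊗[R] B) M (u ⊗ₜ[R] (1 : B)) * hr0
        | some i =>
          refine ⟨g * 1 ⊗ₜ x i, ?_⟩
          rw [map_mul, map_mul, ← hr1]
          ring
      obtain ⟨s, hs⟩ := this
      refine ⟨n + 1, t * s, ?_⟩
      rw [map_mul π, map_mul _ t, ← h, ← hs]
      ring
  have hψinj : Function.Injective ψ := by
    rw [injective_iff_map_eq_zero]
    intro m hm
    obtain ⟨n, t, ht⟩ := hpow m
    have h1 : algebraMap _ A t = 0 := by
      have := congr(ψ $ht)
      rw [map_mul, hm, mul_zero, AlgHom.commutes] at this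
      exact this.symm
    rw [hKB, IsLocalization.map_eq_zero_iff (Submonoid.powers G)] at h1
    obtain ⟨⟨_, k, rfl⟩, hk⟩ := h1
    have h2 : g ^ k * t = 0 := by
      apply hinj
      simpa [hG] using hk
    refine hreg m (n + k) ?_
    have h3 : (u ⊗ₜ[R] (1 : B) * g) ^ k * t = 0 := by
      rw [mul_pow]
      linear_combination (u ⊗ₜ[R] (1 : B)) ^ k * h2
    have h4 := congr(algebraMap (K ⊗[R] B) M $h3)
    rw [map_mul, map_pow, map_zero, ← ht] at h4
    linear_combination h4
  have hψsurj : Function.Surjective ψ := by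
    intro a
    obtain ⟨e, ⟨_, k, rfl⟩, rfl⟩ := IsLocalization.exists_mk'_eq (Submonoid.powers G) a
    obtain ⟨n, P, hP⟩ := hsurj e
    have h1 : algebraMap E A (MvPolynomial.aeval y P) = F (MvPolynomial.rename some P) := by
      simp only [F, MvPolynomial.aeval_rename]
      rw [← MvPolynomial.aeval_algebraMap_apply]
      rfl
    refine ⟨π (MvPolynomial.X none ^ (n + k) * MvPolynomial.rename some P), ?_⟩
    rw [hψπ, map_mul, ← h1, hP, map_pow]
    rw [IsLocalization.eq_mk'_iff_mul_eq]
    have h2 : F (MvPolynomial.X none) = z := by simp [F, v]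
    have h3 : z ^ (n + k) * algebraMap E A G ^ (n + k) = 1 := by
      rw [← mul_pow, mul_comm, hz, one_pow]
    simp only [h2, map_mul, map_pow]
    linear_combination algebraMap E A e * h3
  exact Algebra.Smooth.of_equiv ((AlgEquiv.ofBijective ψ ⟨hψinj, hψsurj⟩).restrictScalars K)
theorem ReesModel.smooth_localization [Algebra.Smooth R B] {ι : Type u} [Fintype ι] [DecidableEq ι]
    (u : K) (hu : u ∈ nonZeroDivisors K)
    (x : ι → B) (g : K ⊗[R] B) (D : ι → Derivation R B B)
    (hD : ∀ i j, (1 : K) ⊗ₜ[R] (D i (x j)) = if i = j then g else 0)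
    {E : Type u} [CommRing E] [Algebra K E] [Algebra (K ⊗[R] B) E] [IsScalarTower K (K ⊗[R] B) E]
    (hinj : Function.Injective (algebraMap (K ⊗[R] B) E)) (y : ι → E)
    (hy : ∀ i, algebraMap K E u * y i = algebraMap (K ⊗[R] B) E (1 ⊗ₜ x i))
    (hsurj : ∀ e : E, ∃ (n : ℕ) (P : MvPolynomial ι (K ⊗[R] B)),
      MvPolynomial.aeval y P = algebraMap (K ⊗[R] B) E g ^ n * e) :
    Algebra.Smooth K (Localization.Away (algebraMap (K ⊗[R] B) E g)) := by
  have hsm := ReesModel.smooth u x g D hD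
  have hrel (o) : Ideal.Quotient.mkₐ (K ⊗[R] B) (Ideal.span (Set.range (reesRel u x g)))
      (reesRel u x g o) = 0 :=
    Ideal.Quotient.eq_zero_iff_mem.mpr (Ideal.subset_span ⟨o, rfl⟩)
  have hπs : Function.Surjective
      (Ideal.Quotient.mkₐ (K ⊗[R] B) (Ideal.span (Set.range (reesRel u x g)))) :=
    Ideal.Quotient.mk_surjective
  refine reesModel_core u hu x g hinj y hy hsurj (M := ReesModel u x g)
    (Ideal.Quotient.mkₐ (K ⊗[R] B) (Ideal.span (Set.range (reesRel u x g)))) hπs hrel ?_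
  intro F hF
  refine ⟨Ideal.Quotient.liftₐ _ F ?_, fun P => rfl⟩
  change Ideal.span (Set.range (reesRel u x g)) ≤ RingHom.ker F.toRingHom
  rw [Ideal.span_le]
  rintro _ ⟨o, rfl⟩
  exact hF o
end L2

theorem rees_local_gens {B : Type*} [CommRing B] (J : Ideal B) [Module.Finite B J]
    (p : Ideal B) [p.IsPrime] :
    ∃ (n : ℕ) (x : Fin n → J) (f : Fin n → (J →ₗ[B] p.ResidueField)) (g : B), g ∉ p ∧
      (∀ i j, f i (x j) = if i = j then 1 else 0) ∧
      ∀ j : J, g * j ∈ Ideal.span (Set.range fun i => (x i : B)) := by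
  classical
  let k := p.ResidueField
  let v : J → k ⊗[B] J := fun j => 1 ⊗ₜ j
  obtain ⟨κ, a, ha, hspan, hli⟩ := exists_linearIndependent' k v
  have htop : Submodule.span k (Set.range v) = ⊤ := by
    have := Submodule.baseChange_span k (Set.univ : Set J) (R := B)
    rw [Submodule.span_univ, Submodule.baseChange_top, Set.image_univ] at this
    exact this.symm
  rw [htop] at hspan
  let b : Module.Basis κ k (k ⊗[B] J) := Module.Basis.mk hli hspan.ge
  have : Finite κ := Module.Finite.finite_basis b
  obtain ⟨n, ⟨e⟩⟩ := Finite.exists_equiv_fin κ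
  let b' := b.reindex e
  have hb' (i) : b' i = 1 ⊗ₜ (a (e.symm i)) := by simp [b', b, v]
  let x : Fin n → J := fun i => a (e.symm i)
  let Q := J ⧸ Submodule.span B (Set.range x)
  have hQ : Subsingleton (k ⊗[B] Q) := by
    let q := (Submodule.mkQ (Submodule.span B (Set.range x))).baseChange k
    have hq : Function.Surjective q := by
      exact LinearMap.lTensor_surjective _ (Submodule.mkQ_surjective _)
    have h0 : q = 0 := by
      apply b'.ext
      intro i
      rw [hb']
      have : (Submodule.mkQ (Submodule.span B (Set.range x))) (a (e.symm i)) = 0 := by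
        rw [Submodule.mkQ_apply, Submodule.Quotient.mk_eq_zero]
        exact Submodule.subset_span ⟨i, rfl⟩
      simp only [q, LinearMap.baseChange_tmul, this, tmul_zero, LinearMap.zero_apply]
    refine ⟨fun s t => ?_⟩
    obtain ⟨s, rfl⟩ := hq s
    obtain ⟨t, rfl⟩ := hq t
    simp [h0]
  have hsupp : (⟨p, inferInstance⟩ : PrimeSpectrum B) ∉ Module.support B Q := by
    rw [Module.mem_support_iff_nontrivial_residueField_tensorProduct]
    exact not_nontrivial_iff_subsingleton.mpr hQ
  rw [Module.mem_support_iff_of_finite, SetLike.not_le_iff_exists] at hsupp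
  obtain ⟨g, hg, hgp⟩ := hsupp
  refine ⟨n, x, fun i => (b'.coord i).restrictScalars B ∘ₗ TensorProduct.mk B k J 1, g, hgp, ?_, ?_⟩
  · intro i j
    have : (1 : k) ⊗ₜ[B] x j = b' j := (hb' j).symm
    simp [k] at this ⊢
    rw [this]
    simp [Finsupp.single_apply, eq_comm]
  · intro j
    have := Module.mem_annihilator.mp hg (Submodule.Quotient.mk j)
    rw [← Submodule.Quotient.mk_smul, Submodule.Quotient.mk_eq_zero] at this
    have h2 := Submodule.mem_map_of_mem (f := J.subtype) this
    rw [Submodule.map_span, ← Set.range_comp] at h2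
    exact h2

theorem rees_local_data {R B C : Type*} [CommRing R] [CommRing B] [CommRing C] [Algebra R B]
    [Algebra R C] [Algebra B C] [IsScalarTower R B C] [Algebra.Smooth R B] [Algebra.Smooth R C]
    [IsNoetherianRing B]
    (hs : Function.Surjective (algebraMap B C)) (p : Ideal B) [p.IsPrime]
    (hp : RingHom.ker (algebraMap B C) ≤ p) :
    ∃ (n : ℕ) (x : Fin n → B) (D : Fin n → Derivation R B B) (g : B), g ∉ p ∧
      (∀ i, x i ∈ RingHom.ker (algebraMap B C)) ∧
      (∀ i j, D i (x j) = if i = j then g else 0) ∧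
      ∀ j ∈ RingHom.ker (algebraMap B C), g * j ∈ Ideal.span (Set.range x) := by
  classical
  set J := RingHom.ker (algebraMap B C) with hJ
  obtain ⟨n, x, f, g0, hg0, hf, hgJ⟩ := rees_local_gens J p
  obtain ⟨l, hl⟩ := (Algebra.FormallySmooth.iff_split_injection (R := R) hs).mp inferInstance
  have hl' (j : J) : l (1 ⊗ₜ KaehlerDifferential.D R B j) = J.toCotangent j := by
    rw [← KaehlerDifferential.kerCotangentToTensor_toCotangent]
    exact congr($hl (J.toCotangent j))
  have hker (a : B) (ha : a ∈ p) : algebraMap B p.ResidueField a = 0 := by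
    simpa using ha
  let F (i) : J.Cotangent →ₗ[B] p.ResidueField :=
    Submodule.liftQ _ (f i) (by
      rw [Submodule.smul_le]
      rintro a ha j -
      rw [LinearMap.mem_ker, map_smul, Algebra.smul_def, hker a (hp ha), zero_mul])
  have hF (i) (j : J) : F i (J.toCotangent j) = f i j := rfl
  let G (i) : Ω[B⁄R] →ₗ[B] p.ResidueField :=
    F i ∘ₗ l.restrictScalars B ∘ₗ TensorProduct.mk B C _ 1
  have hG (i j) : G i (KaehlerDifferential.D R B (x j)) = if i = j then 1 else 0 := by
    rw [← hf, ← hF, ← hl']; rfl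
  obtain ⟨m, π, s, -, -, hπs⟩ := Module.Finite.exists_comp_eq_id_of_projective B Ω[B⁄R]
  obtain ⟨d, hd⟩ := IsLocalization.exist_integer_multiples_of_finite (nonZeroDivisors (B ⧸ p))
    (fun ik : Fin n × Fin m => G ik.1 (π (Pi.single ik.2 1)))
  obtain ⟨d, hd0⟩ := d
  obtain ⟨d, rfl⟩ := Ideal.Quotient.mk_surjective d
  have hdp : d ∉ p := fun h => nonZeroDivisors.ne_zero hd0 (Ideal.Quotient.eq_zero_iff_mem.mpr h)
  have hd' : ∀ ik : Fin n × Fin m, ∃ a : B, algebraMap B p.ResidueField a =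
      algebraMap B p.ResidueField d * G ik.1 (π (Pi.single ik.2 1)) := by
    intro ik
    obtain ⟨a, ha⟩ := hd ik
    obtain ⟨a, rfl⟩ := Ideal.Quotient.mk_surjective a
    refine ⟨a, ?_⟩
    simp only [Algebra.smul_def] at ha
    exact ha
  choose a ha using hd'
  let L (i) : Ω[B⁄R] →ₗ[B] B := ∑ k, a (i, k) • (LinearMap.proj k ∘ₗ s)
  have hL (i) (ω) : algebraMap B p.ResidueField (L i ω) = algebraMap B p.ResidueField d * G i ω := by
    have h1 : ω = π (s ω) := congr($hπs.symm ω)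
    conv_rhs => rw [h1, pi_eq_sum_univ' (s ω)]
    simp only [L, LinearMap.sum_apply, LinearMap.smul_apply, LinearMap.comp_apply,
      LinearMap.proj_apply, map_sum, map_smul, smul_eq_mul, map_mul, ha, Finset.mul_sum]
    refine Finset.sum_congr rfl fun k _ => ?_
    rw [Algebra.smul_def]
    ring
  let M : Matrix (Fin n) (Fin n) B :=
    Matrix.of fun i j => L i (KaehlerDifferential.D R B (x j))
  have hMa (i j) : M i j = L i (KaehlerDifferential.D R B (x j)) := rfl
  have hM : M.det ∉ p := by
    intro h
    have h1 := hker _ h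
    rw [RingHom.map_det] at h1
    have h2 : (algebraMap B p.ResidueField).mapMatrix M =
        algebraMap B p.ResidueField d • (1 : Matrix (Fin n) (Fin n) p.ResidueField) := by
      ext i j
      simp [hMa, hL, hG, Matrix.one_apply]
    rw [h2, Matrix.det_smul, Matrix.det_one, mul_one] at h1
    have h3 := eq_zero_of_pow_eq_zero h1
    exact hdp (by simpa using h3)
  let D (i) : Derivation R B B := (g0 • ∑ k, M.adjugate i k • L k).compDer (KaehlerDifferential.D R B)
  refine ⟨n, fun i => x i, D, g0 * M.det, ?_, fun i => (x i).2, ?_, ?_⟩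
  · intro h
    exact ((‹p.IsPrime›).mem_or_mem h).elim hg0 hM
  · intro i j
    have h := congr($(Matrix.adjugate_mul M) i j)
    simp only [Matrix.mul_apply, Matrix.smul_apply, Matrix.one_apply, hMa] at h
    have : D i (x j) = g0 * ∑ k, M.adjugate i k * L k (KaehlerDifferential.D R B (x j)) := by
      simp [D]
    rw [this, h]
    split_ifs <;> simp
  · intro j hj
    have := Ideal.mul_mem_left _ M.det (hgJ ⟨j, hj⟩)
    convert this using 1
    ring

section L4
universe u

theorem smooth_of_local {K E : Type u} [CommRing K] [CommRing E] [Algebra K E]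
    (h : ∀ q : Ideal E, q.IsPrime → ∃ d ∉ q, Algebra.Smooth K (Localization.Away d)) :
    Algebra.Smooth K E := by
  rw [← RingHom.smooth_algebraMap]
  refine RingHom.Smooth.ofLocalizationSpanTarget (algebraMap K E)
    {d | Algebra.Smooth K (Localization.Away d)} ?_ ?_
  · by_contra hne
    obtain ⟨m, hm, hle⟩ := Ideal.exists_le_maximal _ hne
    obtain ⟨d, hd, hs⟩ := h m hm.isPrime
    exact hd (hle (Ideal.subset_span hs))
  · rintro ⟨d, hd⟩
    rw [← IsScalarTower.algebraMap_eq, RingHom.smooth_algebraMap]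
    exact hd

variable (R B : Type u) [CommRing R] [CommRing B] [Algebra R B] (J : Ideal B)

/-- the polynomial algebra structure -/
noncomputable abbrev reesAlg : Algebra (Polynomial R) ↥(extendedRees R B J) :=
  (Polynomial.aeval (⟨T 1, u_mem_extendedRees J⟩ : ↥(extendedRees R B J))).toRingHom.toAlgebra

/-- inclusion of B -/
noncomputable def reesB : B →ₐ[R] extendedRees R B J where
  toFun b := ⟨LaurentPolynomial.C b, Algebra.subset_adjoin (Or.inr (Or.inl ⟨b, rfl⟩))⟩
  map_one' := by ext1; simp
  map_zero' := by ext1; simp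
  map_mul' a b := by ext1; simp
  map_add' a b := by ext1; simp
  commutes' r := by ext1; rfl

/-- the elements j/u -/
noncomputable def reesJ (j : B) (hj : j ∈ J) : extendedRees R B J :=
  ⟨LaurentPolynomial.C j * T (-1), Algebra.subset_adjoin (Or.inr (Or.inr ⟨j, hj, rfl⟩))⟩

theorem reesT_mul_reesJ (j : B) (hj : j ∈ J) :
    (⟨T 1, u_mem_extendedRees J⟩ : extendedRees R B J) * reesJ R B J j hj = reesB R B J j := by
  ext1
  change T 1 * (LaurentPolynomial.C j * T (-1)) = LaurentPolynomial.C j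
  rw [mul_left_comm, ← T_add]
  simp

attribute [local instance] reesAlg in
theorem rees_tower : IsScalarTower R (Polynomial R) (extendedRees R B J) :=
  .of_algebraMap_eq fun r => by
    change _ = Polynomial.aeval _ _
    simp

attribute [local instance] reesAlg rees_tower in
/-- the map K ⊗ B → D -/
noncomputable def reesMap : (Polynomial R ⊗[R] B) →ₐ[Polynomial R] extendedRees R B J :=
  Algebra.TensorProduct.productLeftAlgHom (Algebra.ofId _ _) (reesB R B J)

attribute [local instance] reesAlg rees_tower in
theorem reesMap_injective : Function.Injective (reesMap R B J) := by
  have h : ((extendedRees R B J).val.comp ((reesMap R B J).restrictScalars R)) =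
    ((Polynomial.toLaurentAlg (R := B)).restrictScalars R).comp
      (((polyEquivTensor R B).symm.toAlgHom).comp
        (Algebra.TensorProduct.comm R (Polynomial R) B).toAlgHom) := by
    apply Algebra.TensorProduct.ext
    · apply Polynomial.algHom_ext
      simp [reesMap, Algebra.ofId_apply]
      change ((Polynomial.aeval _ (Polynomial.X : Polynomial R) : extendedRees R B J) : LaurentPolynomial B) = _
      simp
    · ext1 b
      simp [reesMap, reesB]
      rw [Polynomial.smul_eq_C_mul, mul_one, Polynomial.toLaurent_C]
  have h2 : Function.Injective
      ((extendedRees R B J).val.comp ((reesMap R B J).restrictScalars R)) := by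
    rw [h]
    exact Polynomial.toLaurent_injective.comp ((polyEquivTensor R B).symm.injective.comp
      (Algebra.TensorProduct.comm R (Polynomial R) B).injective)
  intro a b hab
  exact h2 (congrArg (extendedRees R B J).val hab)

attribute [local instance] reesAlg rees_tower in
theorem rees_loc [Algebra.Smooth R B] {ι : Type u} [Fintype ι] [DecidableEq ι]
    (x : ι → B) (hx : ∀ i, x i ∈ J) (g : Polynomial R ⊗[R] B) (D : ι → Derivation R B B)
    (hD : ∀ i j, (1 : Polynomial R) ⊗ₜ[R] (D i (x j)) = if i = j then g else 0)
    (hJ : ∀ j hj, ∃ (b : B) (a : ι → B), reesMap R B J g * reesJ R B J j hj =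
      reesB R B J b + ∑ i, reesB R B J (a i) * reesJ R B J (x i) (hx i)) :
    Algebra.Smooth (Polynomial R) (Localization.Away (reesMap R B J g)) := by
  let _ : Algebra (Polynomial R ⊗[R] B) (extendedRees R B J) := (reesMap R B J).toRingHom.toAlgebra
  have halg (t) : algebraMap (Polynomial R ⊗[R] B) (extendedRees R B J) t = reesMap R B J t := rfl
  have : IsScalarTower (Polynomial R) (Polynomial R ⊗[R] B) (extendedRees R B J) :=
    IsScalarTower.of_algebraMap_eq (R := Polynomial R) (S := Polynomial R ⊗[R] B)
      (A := extendedRees R B J) fun k => by rw [halg, AlgHom.commutes]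
  have hX : algebraMap (Polynomial R) (extendedRees R B J) Polynomial.X =
      ⟨T 1, u_mem_extendedRees J⟩ := Polynomial.aeval_X _
  have hB (b) : reesMap R B J (1 ⊗ₜ b) = reesB R B J b := by simp [reesMap]
  let y : ι → extendedRees R B J := fun i => reesJ R B J (x i) (hx i)
  refine ReesModel.smooth_localization (Polynomial.X : Polynomial R)
    Polynomial.monic_X.mem_nonZeroDivisors x g D hD (E := extendedRees R B J)
    (reesMap_injective R B J) y ?_ ?_
  · intro i
    rw [hX, reesT_mul_reesJ, halg, hB]
  · rintro ⟨e, he⟩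
    rw [halg]
    induction he using Algebra.adjoin_induction with
    | mem e he =>
      rcases he with rfl | ⟨b, rfl⟩ | ⟨j, hj, rfl⟩
      · refine ⟨0, MvPolynomial.C (Polynomial.X ⊗ₜ 1), ?_⟩
        rw [MvPolynomial.aeval_C, pow_zero, one_mul, ← hX]
        exact (IsScalarTower.algebraMap_apply (Polynomial R) (Polynomial R ⊗[R] B) _ _).symm
      · refine ⟨0, MvPolynomial.C (1 ⊗ₜ b), ?_⟩
        rw [MvPolynomial.aeval_C, pow_zero, one_mul, halg, hB]
        rfl
      · obtain ⟨b, a, hba⟩ := hJ j hj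
        refine ⟨1, MvPolynomial.C (1 ⊗ₜ b) + ∑ i, MvPolynomial.C (1 ⊗ₜ a i) * MvPolynomial.X i, ?_⟩
        rw [pow_one]
        refine Eq.trans ?_ hba.symm
        simp only [map_add, map_sum, map_mul, MvPolynomial.aeval_C, MvPolynomial.aeval_X, halg, hB, y]
    | algebraMap r =>
      refine ⟨0, MvPolynomial.C (algebraMap R _ r), ?_⟩
      rw [MvPolynomial.aeval_C, pow_zero, one_mul, halg,
        IsScalarTower.algebraMap_apply R (Polynomial R) (Polynomial R ⊗[R] B), AlgHom.commutes,
        ← IsScalarTower.algebraMap_apply]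
      rfl
    | add e f he hf ihe ihf =>
      obtain ⟨n, P, hP⟩ := ihe
      obtain ⟨m, Q, hQ⟩ := ihf
      refine ⟨n + m, MvPolynomial.C (g ^ m) * P + MvPolynomial.C (g ^ n) * Q, ?_⟩
      have : (⟨e + f, add_mem he hf⟩ : extendedRees R B J) = ⟨e, he⟩ + ⟨f, hf⟩ := rfl
      rw [this, map_add, map_mul, map_mul, hP, hQ, MvPolynomial.aeval_C, MvPolynomial.aeval_C,
        halg, halg, map_pow, map_pow]
      ring
    | mul e f he hf ihe ihf =>
      obtain ⟨n, P, hP⟩ := ihe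
      obtain ⟨m, Q, hQ⟩ := ihf
      refine ⟨n + m, P * Q, ?_⟩
      have : (⟨e * f, mul_mem he hf⟩ : extendedRees R B J) = ⟨e, he⟩ * ⟨f, hf⟩ := rfl
      rw [this, map_mul, hP, hQ]
      ring
attribute [local instance] reesAlg rees_tower in
theorem rees_final (R B C : Type u) [CommRing R] [IsNoetherianRing R]
    [CommRing B] [CommRing C] [Algebra R B] [Algebra R C]
    [Algebra.Smooth R B] [Algebra.Smooth R C]
    (p : B →ₐ[R] C) (hp : Function.Surjective p) :
    Algebra.Smooth (Polynomial R) (extendedRees R B (RingHom.ker p.toRingHom)) := by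
  let J := RingHom.ker p.toRingHom
  refine smooth_of_local fun q hq => ?_
  have hB (b) : reesMap R B J (1 ⊗ₜ b) = reesB R B J b := by simp [reesMap]
  by_cases hu : (⟨T 1, u_mem_extendedRees J⟩ : extendedRees R B J) ∈ q
  · let _ : Algebra B C := p.toRingHom.toAlgebra
    have : IsScalarTower R B C := .of_algebraMap_eq fun r => (p.commutes r).symm
    have : IsNoetherianRing B := Algebra.FiniteType.isNoetherianRing R B
    let P := q.comap (reesB R B J).toRingHom
    have hP : RingHom.ker (algebraMap B C) ≤ P := by
      intro j hj
      change reesB R B J j ∈ q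
      rw [← reesT_mul_reesJ R B J j hj]
      exact q.mul_mem_right _ hu
    obtain ⟨n, x, D, g, hg, hx, hD, hgJ⟩ := rees_local_data (R := R) (C := C) hp P hP
    refine ⟨reesMap R B J (1 ⊗ₜ g), ?_, ?_⟩
    · rw [hB]; exact hg
    · refine rees_loc R B J (fun i : ULift (Fin n) => x i.down) (fun i => hx i.down) (1 ⊗ₜ g)
        (fun i => D i.down) ?_ ?_
      · rintro ⟨i⟩ ⟨j⟩
        simp only [hD, ULift.up_inj]
        split_ifs <;> simp
      · intro j hj
        obtain ⟨a, ha⟩ := Ideal.mem_span_range_iff_exists_fun.mp (hgJ j hj)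
        refine ⟨0, fun i => a i.down, ?_⟩
        rw [hB]
        ext1
        rw [map_zero, zero_add]
        refine Eq.trans ?_ (congrArg Subtype.val (Equiv.ulift.sum_comp
          (fun i => reesB R B J (a i) * reesJ R B J (x i) (hx i))).symm)
        simp only [AddSubmonoidClass.coe_finsetSum, MulMemClass.coe_mul]
        change LaurentPolynomial.C g * (LaurentPolynomial.C j * T (-1)) =
          ∑ i, LaurentPolynomial.C (a i) * (LaurentPolynomial.C (x i) * T (-1))
        rw [← mul_assoc, ← map_mul, ← ha, map_sum, Finset.sum_mul]
        simp only [map_mul, mul_assoc]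
  · have hX : reesMap R B J (Polynomial.X ⊗ₜ 1) = ⟨T 1, u_mem_extendedRees J⟩ := by
      simp [reesMap, Algebra.ofId_apply]
      exact Polynomial.aeval_X _
    refine ⟨reesMap R B J (Polynomial.X ⊗ₜ 1), ?_, ?_⟩
    · rwa [hX]
    · refine rees_loc R B J (fun i : PEmpty => i.elim) (fun i => i.elim) (Polynomial.X ⊗ₜ 1)
        (fun i => i.elim) (fun i => i.elim) ?_
      intro j hj
      refine ⟨j, fun i => i.elim, ?_⟩
      rw [hX, reesT_mul_reesJ]
      simp
end L4

theorem extendedRees_smooth (R B C : Type u) [CommRing R] [IsNoetherianRing R]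
    [CommRing B] [CommRing C] [Algebra R B] [Algebra R C]
    [Algebra.Smooth R B] [Algebra.Smooth R C]
    (p : B →ₐ[R] C) (hp : Function.Surjective p) :
    letI : Algebra (Polynomial R) ↥(extendedRees R B (RingHom.ker p.toRingHom)) :=
      (Polynomial.aeval
        (⟨T 1, u_mem_extendedRees (RingHom.ker p.toRingHom)⟩ :
          ↥(extendedRees R B (RingHom.ker p.toRingHom)))).toRingHom.toAlgebra
    Algebra.Smooth (Polynomial R) ↥(extendedRees R B (RingHom.ker p.toRingHom)) := by
  exact rees_final R B C p hp
end
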